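/- Let b ≠ b' be points of S¹ and let g₀ be an oriented-geodesic frame for (b', b). Then P(g₀·0, b) = 2/|b − b'|; equivalently, the Busemann function ⟨g₀·0, b⟩ = log P(g₀·0, b) equals −log(|b − b'|/2). -/

import Mathlib

open Complex MeasureTheory Real

noncomputable section

/-- Möbius action of a 2×2 complex matrix on ℂ. -/
def moeb (g : Matrix (Fin 2) (Fin 2) ℂ) (w : ℂ) : ℂ :=
  (g 0 0 * w + g 0 1) / (g 1 0 * w + g 1 1)

/-- The predicate defining SU(1,1) matrices. -/
def IsSU11 (g : Matrix (Fin 2) (Fin 2) ℂ) : Prop :=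
  g 1 0 = (starRingEnd ℂ) (g 0 1) ∧ g 1 1 = (starRingEnd ℂ) (g 0 0) ∧
    ‖g 0 0‖ ^ 2 - ‖g 0 1‖ ^ 2 = 1

/-- Poisson kernel on 𝔻 × S¹. -/
def Pk (z b : ℂ) : ℝ := (1 - ‖z‖ ^ 2) / ‖z - b‖ ^ 2

/-- `g₀` is an oriented-geodesic frame for the pair of boundary points `(b', b)`. -/
def frameFor (g₀ : Matrix (Fin 2) (Fin 2) ℂ) (b' b : ℂ) : Prop :=
  IsSU11 g₀ ∧ moeb g₀ 1 = b ∧ moeb g₀ (-1) = b' ∧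
    ‖moeb g₀ 0 - b‖ = ‖moeb g₀ 0 - b'‖

/-- The complex form of the determinant condition for SU(1,1). -/
lemma IsSU11.det_eq_one {g : Matrix (Fin 2) (Fin 2) ℂ} (hg : IsSU11 g) :
    g 0 0 * (starRingEnd ℂ) (g 0 0) - g 0 1 * (starRingEnd ℂ) (g 0 1) = 1 := by
  rw [Complex.mul_conj', Complex.mul_conj']
  exact_mod_cast hg.2.2

/-- The first row of an SU(1,1) matrix has nonzero sum. -/
lemma IsSU11.add_ne_zero {g : Matrix (Fin 2) (Fin 2) ℂ} (hg : IsSU11 g) :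
    g 0 0 + g 0 1 ≠ 0 := by
  intro h
  have h2 := hg.2.2
  rw [eq_neg_of_add_eq_zero_left h, norm_neg] at h2
  simp at h2

/-- The first row of an SU(1,1) matrix has nonzero difference. -/
lemma IsSU11.sub_ne_zero {g : Matrix (Fin 2) (Fin 2) ℂ} (hg : IsSU11 g) :
    g 0 0 - g 0 1 ≠ 0 := by
  intro h
  have h2 := hg.2.2
  rw [_root_.sub_eq_zero.mp h] at h2
  simp at h2

/-- The first entry of an SU(1,1) matrix is nonzero. -/
lemma IsSU11.apply_zero_zero_ne_zero {g : Matrix (Fin 2) (Fin 2) ℂ} (hg : IsSU11 g) :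
    g 0 0 ≠ 0 := by
  intro h
  have h2 := hg.2.2
  rw [h, norm_zero] at h2
  nlinarith [sq_nonneg ‖g 0 1‖]

lemma IsSU11.moeb_zero {g : Matrix (Fin 2) (Fin 2) ℂ} (hg : IsSU11 g) :
    moeb g 0 = g 0 1 / (starRingEnd ℂ) (g 0 0) := by
  simp [moeb, hg.2.1]

lemma IsSU11.moeb_one {g : Matrix (Fin 2) (Fin 2) ℂ} (hg : IsSU11 g) :
    moeb g 1 = (g 0 0 + g 0 1) / (starRingEnd ℂ) (g 0 0 + g 0 1) := by
  simp [moeb, hg.1, hg.2.1, add_comm]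

lemma IsSU11.moeb_neg_one {g : Matrix (Fin 2) (Fin 2) ℂ} (hg : IsSU11 g) :
    moeb g (-1) = -(g 0 0 - g 0 1) / (starRingEnd ℂ) (g 0 0 - g 0 1) := by
  simp only [moeb, hg.1, hg.2.1, map_sub]
  ring

lemma IsSU11.norm_moeb_zero_sub_moeb_one {g : Matrix (Fin 2) (Fin 2) ℂ} (hg : IsSU11 g) :
    ‖moeb g 0 - moeb g 1‖ = 1 / (‖g 0 0‖ * ‖g 0 0 + g 0 1‖) := by
  have hα := (map_ne_zero (starRingEnd ℂ)).mpr hg.apply_zero_zero_ne_zero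
  have hu := (map_ne_zero (starRingEnd ℂ)).mpr hg.add_ne_zero
  have key : moeb g 0 - moeb g 1 =
      -1 / ((starRingEnd ℂ) (g 0 0) * (starRingEnd ℂ) (g 0 0 + g 0 1)) := by
    rw [hg.moeb_zero, hg.moeb_one, div_sub_div _ _ hα hu]
    congr 1
    rw [map_add]
    linear_combination -hg.det_eq_one
  rw [key, norm_div, norm_mul, RCLike.norm_conj, RCLike.norm_conj, norm_neg, norm_one]

lemma IsSU11.norm_moeb_zero_sub_moeb_neg_one {g : Matrix (Fin 2) (Fin 2) ℂ}
    (hg : IsSU11 g) :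
    ‖moeb g 0 - moeb g (-1)‖ = 1 / (‖g 0 0‖ * ‖g 0 0 - g 0 1‖) := by
  have hα := (map_ne_zero (starRingEnd ℂ)).mpr hg.apply_zero_zero_ne_zero
  have hv := (map_ne_zero (starRingEnd ℂ)).mpr hg.sub_ne_zero
  have key : moeb g 0 - moeb g (-1) =
      1 / ((starRingEnd ℂ) (g 0 0) * (starRingEnd ℂ) (g 0 0 - g 0 1)) := by
    rw [hg.moeb_zero, hg.moeb_neg_one, div_sub_div _ _ hα hv]
    congr 1
    rw [map_sub]
    linear_combination hg.det_eq_one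
  rw [key, norm_div, norm_mul, RCLike.norm_conj, RCLike.norm_conj, norm_one]

lemma IsSU11.norm_moeb_one_sub_moeb_neg_one {g : Matrix (Fin 2) (Fin 2) ℂ}
    (hg : IsSU11 g) :
    ‖moeb g 1 - moeb g (-1)‖ = 2 / (‖g 0 0 + g 0 1‖ * ‖g 0 0 - g 0 1‖) := by
  have hu := (map_ne_zero (starRingEnd ℂ)).mpr hg.add_ne_zero
  have hv := (map_ne_zero (starRingEnd ℂ)).mpr hg.sub_ne_zero
  have key : moeb g 1 - moeb g (-1) =
      2 / ((starRingEnd ℂ) (g 0 0 + g 0 1) * (starRingEnd ℂ) (g 0 0 - g 0 1)) := by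
    rw [hg.moeb_one, hg.moeb_neg_one, div_sub_div _ _ hu hv]
    congr 1
    rw [map_add, map_sub]
    linear_combination 2 * hg.det_eq_one
  rw [key, norm_div, norm_mul, RCLike.norm_conj, RCLike.norm_conj, RCLike.norm_ofNat]

/-- The Poisson kernel at `g·0` and `g·1` is the squared modulus of `g 0 0 + g 0 1`. -/
lemma IsSU11.Pk_moeb_zero_moeb_one {g : Matrix (Fin 2) (Fin 2) ℂ} (hg : IsSU11 g) :
    Pk (moeb g 0) (moeb g 1) = ‖g 0 0 + g 0 1‖ ^ 2 := by
  have hα := norm_ne_zero_iff.mpr hg.apply_zero_zero_ne_zero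
  have hu := norm_ne_zero_iff.mpr hg.add_ne_zero
  rw [Pk, hg.norm_moeb_zero_sub_moeb_one, hg.moeb_zero, norm_div, RCLike.norm_conj]
  field_simp
  exact hg.2.2

/-- For an oriented-geodesic frame `g₀` for `(b', b)` one has
`P(g₀·0, b) = 2/|b−b'|`, i.e. the Busemann function `⟨g₀·0, b⟩ = log P(g₀·0, b)`
equals `−log(|b−b'|/2)`. -/
theorem busemann_at_midpoint (b b' : ℂ) (hb : ‖b‖ = 1) (hb' : ‖b'‖ = 1) (hne : b ≠ b')
    (g₀ : Matrix (Fin 2) (Fin 2) ℂ) (hg₀ : frameFor g₀ b' b) :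
    Pk (moeb g₀ 0) b = 2 / ‖b - b'‖ ∧
    Real.log (Pk (moeb g₀ 0) b) = - Real.log (‖b - b'‖ / 2) := by
  obtain ⟨hg, rfl, rfl, hmid⟩ := hg₀
  have hα := norm_ne_zero_iff.mpr hg.apply_zero_zero_ne_zero
  have huv : ‖g₀ 0 0 - g₀ 0 1‖ = ‖g₀ 0 0 + g₀ 0 1‖ := by
    rw [hg.norm_moeb_zero_sub_moeb_one, hg.norm_moeb_zero_sub_moeb_neg_one,
      one_div, one_div, inv_inj] at hmid
    exact (mul_left_cancel₀ hα hmid).symm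
  have hP : Pk (moeb g₀ 0) (moeb g₀ 1) = 2 / ‖moeb g₀ 1 - moeb g₀ (-1)‖ := by
    rw [hg.Pk_moeb_zero_moeb_one, hg.norm_moeb_one_sub_moeb_neg_one, huv,
      div_div_cancel₀ two_ne_zero, sq]
  exact ⟨hP, by rw [hP, ← Real.log_inv, inv_div]⟩
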